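/- Let θ ∈ (0,π), l > 0, and set κ := −θ/l. Let a, c ∈ ℝ and let u : ℝ → ℝ be four times continuously differentiable on [−l, l] satisfying u''''(x) + κ²·u''(x) = a·sin(κx) + c·(1 − cos θ · cos(κx)) for all x ∈ [−l, l], together with the no-flux boundary conditions u'''(l) + κ²u'(l) = 0 and u'''(−l) + κ²u'(−l) = 0. Then c = 0. -/

import Mathlib

/-- On a set of unique differentiability, the `m`-th iterated derivative of a `C^n` function with
`m < n` has the `(m + 1)`-st iterated derivative as its derivative. -/
theorem ContDiffOn.hasDerivWithinAt_iteratedDerivWithin {f : ℝ → ℝ} {s : Set ℝ} {n : WithTop ℕ∞}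
    {m : ℕ} (hf : ContDiffOn ℝ n f s) (hmn : m < n) (hs : UniqueDiffOn ℝ s) {x : ℝ} (hx : x ∈ s) :
    HasDerivWithinAt (iteratedDerivWithin m f s) (iteratedDerivWithin (m + 1) f s x) s x := by
  rw [iteratedDerivWithin_succ]
  exact (hf.differentiableOn_iteratedDerivWithin hmn hs x hx).hasDerivWithinAt

theorem Real.sin_mul_cos_lt_self {θ : ℝ} (hθ : 0 < θ) : Real.sin θ * Real.cos θ < θ := by
  have h := Real.sin_lt (x := 2 * θ) (by linarith)
  rw [Real.sin_two_mul] at h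
  linarith


/-- (semi-simplicity of the eigenvalue 0) If
`u'''' + κ² u'' = a sin(κ x) + c (1 - cos θ cos(κ x))` on `[-l, l]` with the no-flux
boundary conditions `u''' + κ² u' = 0` at `x = ± l`, then `c = 0`. -/
theorem semisimplicity_coefficient_vanishes
    (θ l : ℝ) (hθ : θ ∈ Set.Ioo 0 Real.pi) (hl : 0 < l)
    (κ : ℝ) (hκ : κ = -θ / l) (a c : ℝ) (u : ℝ → ℝ)
    (hu : ContDiffOn ℝ 4 u (Set.Icc (-l) l))
    (hODE : ∀ x ∈ Set.Icc (-l) l,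
      iteratedDerivWithin 4 u (Set.Icc (-l) l) x
          + κ ^ 2 * iteratedDerivWithin 2 u (Set.Icc (-l) l) x
        = a * Real.sin (κ * x) + c * (1 - Real.cos θ * Real.cos (κ * x)))
    (hbc3 : iteratedDerivWithin 3 u (Set.Icc (-l) l) l
      + κ ^ 2 * iteratedDerivWithin 1 u (Set.Icc (-l) l) l = 0)
    (hbc4 : iteratedDerivWithin 3 u (Set.Icc (-l) l) (-l)
      + κ ^ 2 * iteratedDerivWithin 1 u (Set.Icc (-l) l) (-l) = 0) :
    c = 0 := by
  have hθ0 : 0 < θ := hθ.1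
  have hκ0 : κ ≠ 0 := by
    rw [hκ]
    exact div_ne_zero (neg_ne_zero.mpr hθ0.ne') hl.ne'
  have hs : UniqueDiffOn ℝ (Set.Icc (-l) l) := uniqueDiffOn_Icc (by linarith)
  let G : ℝ → ℝ := fun x ↦ iteratedDerivWithin 3 u (Set.Icc (-l) l) x
      + κ ^ 2 * iteratedDerivWithin 1 u (Set.Icc (-l) l) x
      - (a * (-Real.cos (κ * x) / κ) + c * (x - Real.cos θ * (Real.sin (κ * x) / κ)))
  have hG : ∀ x ∈ Set.Icc (-l) l, HasDerivWithinAt G 0 (Set.Icc (-l) l) x := by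
    intro x hx
    have h3 := hu.hasDerivWithinAt_iteratedDerivWithin (m := 3) (by norm_num) hs hx
    have h1 := hu.hasDerivWithinAt_iteratedDerivWithin (m := 1) (by norm_num) hs hx
    have hlin : HasDerivAt (fun y ↦ κ * y) κ x := by simpa using (hasDerivAt_id x).const_mul κ
    have hrhs := ((hlin.cos.neg.div_const κ).const_mul a).add
      (((hasDerivAt_id x).sub ((hlin.sin.div_const κ).const_mul (Real.cos θ))).const_mul c)
    refine ((h3.add (h1.const_mul (κ ^ 2))).sub hrhs.hasDerivWithinAt).congr_deriv ?_
    have hode := hODE x hx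
    norm_num at hode ⊢
    rw [hode]
    field_simp
    ring
  have hconst : G l = G (-l) :=
    constant_of_derivWithin_zero (fun x hx ↦ (hG x hx).differentiableWithinAt)
      (fun x hx ↦ (hG x (Set.Ico_subset_Icc_self hx)).derivWithin
        (hs x (Set.Ico_subset_Icc_self hx))) l ⟨by linarith, le_rfl⟩
  have hκl : κ * l = -θ := by
    rw [hκ]
    field_simp
  simp only [G, hbc3, hbc4, mul_neg, hκl, neg_neg, Real.cos_neg, Real.sin_neg] at hconst
  have hc : c * (θ - Real.sin θ * Real.cos θ) = 0 := by
    field_simp at hconst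
    linear_combination (1 / 2) * hconst + c * hκl
  exact (mul_eq_zero.mp hc).resolve_right (sub_pos.mpr (Real.sin_mul_cos_lt_self hθ0)).ne'
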